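/- There exists a constant C > 0 depending only on s and c₀ such that for every quadruple (ξ₁, ξ₂, ξ₃, ξ₄) of real numbers with ξ₁ + ξ₂ + ξ₃ + ξ₄ = 0 and α₃(ξ₁, ξ₂+ξ₃, ξ₄) ≠ 0, the quantity M₄₂(ξ₁,ξ₂,ξ₃,ξ₄) := 2·(ξ₂+ξ₃)·σ₃(ξ₁, ξ₂+ξ₃, ξ₄) satisfies |M₄₂(ξ₁,ξ₂,ξ₃,ξ₄)| ≤ C·N_max^{2s−1}·N^{2−2s}, where N_max := max(|ξ₁|,|ξ₂|,|ξ₃|,|ξ₄|). -/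

import Mathlib

open MeasureTheory Real

noncomputable section

/-- An admissible I-method multiplier `m`, with parameters `s`, `N`, `c₀`. -/
structure AdmissibleMultiplier (s N c₀ : ℝ) (m : ℝ → ℝ) : Prop where
  even : ∀ ξ : ℝ, m (-ξ) = m ξ
  smooth : ContDiff ℝ 2 m
  anti : ∀ ⦃a b : ℝ⦄, 0 ≤ a → a ≤ b → m b ≤ m a
  pos : ∀ ξ : ℝ, 0 < m ξ
  le_one : ∀ ξ : ℝ, m ξ ≤ 1
  eq_one : ∀ ξ : ℝ, |ξ| ≤ N → m ξ = 1
  eq_rpow : ∀ ξ : ℝ, 2 * N ≤ |ξ| → m ξ = N ^ (1 - s) * |ξ| ^ (s - 1)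
  cube_mono : ∀ ⦃a b : ℝ⦄, 0 ≤ a → a ≤ b → a ^ 3 * m a ^ 2 ≤ b ^ 3 * m b ^ 2
  deriv_le : ∀ ξ : ℝ, ξ ≠ 0 → |deriv m ξ| ≤ c₀ * m ξ / |ξ|
  deriv2_le : ∀ ξ : ℝ, ξ ≠ 0 → |deriv (deriv m) ξ| ≤ c₀ * m ξ / ξ ^ 2

/-- The denominator `α₃(ξ₁,ξ₂,ξ₃) = ξ₁³ + 4ξ₂³ + 4ξ₃³`. -/
def alpha3 (ξ₁ ξ₂ ξ₃ : ℝ) : ℝ := ξ₁ ^ 3 + 4 * ξ₂ ^ 3 + 4 * ξ₃ ^ 3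

/-- The multiplier `σ₃` associated with `m₁` (and `m₂(ξ) = m₁(2ξ)`); equal to `0`
by the junk-value convention where `α₃` vanishes. -/
def sigma3 (m₁ : ℝ → ℝ) (ξ₁ ξ₂ ξ₃ : ℝ) : ℝ :=
  (ξ₁ ^ 3 * m₁ ξ₁ ^ 2 + 4 * ξ₂ ^ 3 * m₁ (2 * ξ₂) ^ 2 + 4 * ξ₃ ^ 3 * m₁ (2 * ξ₃) ^ 2) /
    alpha3 ξ₁ ξ₂ ξ₃

/-- A midpoint second difference is controlled by the Lipschitz constant of the derivative. -/
theorem abs_second_difference_le {f f' : ℝ → ℝ} {L R : ℝ}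
    (hf : ∀ x, HasDerivAt f (f' x) x)
    (hL : ∀ x y, |x| ≤ R → |y| ≤ R → |f' x - f' y| ≤ L * |x - y|)
    {c h : ℝ} (h1 : |c + h| ≤ R) (h2 : |c - h| ≤ R) :
    |f (c + h) + f (c - h) - 2 * f c| ≤ 2 * L * h ^ 2 := by
  have hderiv : ∀ t : ℝ, HasDerivAt (fun t => f (c + t * h) + f (c - t * h))
      ((f' (c + t * h) - f' (c - t * h)) * h) t := by
    intro t
    have e1 : HasDerivAt (fun t : ℝ => c + t * h) h t := by
      simpa using ((hasDerivAt_id t).mul_const h).const_add c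
    have e2 : HasDerivAt (fun t : ℝ => c - t * h) (-h) t := by
      simpa using ((hasDerivAt_id t).mul_const h).const_sub c
    exact (((hf _).comp t e1).add ((hf _).comp t e2)).congr_deriv (by ring)
  have key := (convex_Icc (0 : ℝ) 1).norm_image_sub_le_of_norm_hasDerivWithin_le
    (f := fun t => f (c + t * h) + f (c - t * h)) (C := 2 * L * h ^ 2)
    (fun t _ => (hderiv t).hasDerivWithinAt) (fun t ht => ?_)
    (Set.left_mem_Icc.2 zero_le_one) (Set.right_mem_Icc.2 zero_le_one)
  · simp only [Real.norm_eq_abs, one_mul, zero_mul, add_zero, sub_zero, abs_one, mul_one] at key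
    rwa [two_mul (f c)]
  · obtain ⟨ht0, ht1⟩ := ht
    rw [abs_le] at h1 h2
    have b1 : |c + t * h| ≤ R := by
      rw [abs_le]; constructor <;> nlinarith
    have b2 : |c - t * h| ≤ R := by
      rw [abs_le]; constructor <;> nlinarith
    have := hL _ _ b1 b2
    have e : c + t * h - (c - t * h) = t * (2 * h) := by ring
    rw [e, abs_mul, abs_of_nonneg ht0, abs_mul, abs_two] at this
    have hLh : 0 ≤ L * |h| := by
      by_contra! hneg
      have h3 := hL (c + h) (c - h) (abs_le.2 h1) (abs_le.2 h2)
      rw [show c + h - (c - h) = 2 * h by ring, abs_mul, abs_two] at h3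
      linarith [abs_nonneg (f' (c + h) - f' (c - h))]
    rw [Real.norm_eq_abs, abs_mul]
    calc |f' (c + t * h) - f' (c - t * h)| * |h| ≤ (L * (t * (2 * |h|))) * |h| := by gcongr
      _ = t * (2 * (L * |h|) * |h|) := by ring
      _ ≤ 1 * (2 * (L * |h|) * |h|) := by gcongr
      _ = 2 * L * h ^ 2 := by rw [← sq_abs h]; ring

/-- If `f` is odd with `f' 0 = 0` and `f'` is `L`-Lipschitz on `[-R, R]`, then the midpoint second
difference of `f` at `2b, 2c`, divided by `α₃`, is at most of order `L / |b|`. -/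
theorem abs_mul_second_difference_div_le {f f' : ℝ → ℝ} {L R : ℝ} (hL0 : 0 ≤ L)
    (hf : ∀ x, HasDerivAt f (f' x) x) (hodd : ∀ x, f (-x) = -f x) (hf0 : f' 0 = 0)
    (hL : ∀ x y, |x| ≤ R → |y| ≤ R → |f' x - f' y| ≤ L * |x - y|)
    {b c : ℝ} (hb : |2 * b| ≤ R) (hc : |2 * c| ≤ R) (hbc : b + c ≠ 0) (hne : b - c ≠ 0) :
    |2 * b * ((f (2 * b) + f (2 * c) - 2 * f (b + c)) / (6 * (b + c) * (b - c) ^ 2))| ≤ 2 * L := by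
  have hpos : 0 < |b + c| := abs_pos.2 hbc
  have hsq : 0 < (b - c) ^ 2 := by positivity
  have hden : |6 * (b + c) * (b - c) ^ 2| = 6 * |b + c| * (b - c) ^ 2 := by
    rw [abs_mul, abs_mul, abs_of_pos hsq]; norm_num
  rw [abs_mul, abs_div, hden, ← mul_div_assoc, div_le_iff₀ (by positivity), abs_mul, abs_two]
  rcases le_total |b| (2 * |b + c|) with hcase | hcase
  · have h := abs_second_difference_le hf hL (c := b + c) (h := b - c)
      (by rwa [show b + c + (b - c) = 2 * b by ring])
      (by rwa [show b + c - (b - c) = 2 * c by ring])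
    rw [show b + c + (b - c) = 2 * b by ring, show b + c - (b - c) = 2 * c by ring] at h
    calc 2 * |b| * |f (2 * b) + f (2 * c) - 2 * f (b + c)|
        ≤ 2 * (2 * |b + c|) * (2 * L * (b - c) ^ 2) := by gcongr
      _ = 8 * (L * |b + c| * (b - c) ^ 2) := by ring
      _ ≤ 12 * (L * |b + c| * (b - c) ^ 2) := by
          gcongr; norm_num
      _ = _ := by ring
  · have hmem : ∀ {x : ℝ}, |x| ≤ 3 * |b| → |x| ≤ R → |f' x| ≤ 3 * L * |b| := by
      intro x hx hxR
      have := hL x 0 hxR (by simpa using (abs_nonneg _).trans hb)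
      rw [hf0, sub_zero, sub_zero] at this
      nlinarith
    have hc3 : |2 * c| ≤ 3 * |b| := by
      have : |c| ≤ |b + c| + |b| := by
        simpa using abs_sub (b + c) b
      rw [abs_mul, abs_two]; linarith
    have hb3 : |2 * b| ≤ 3 * |b| := by
      rw [abs_mul, abs_two]; linarith [abs_nonneg b]
    have hlip : ∀ x y : ℝ, |x| ≤ 3 * |b| → |x| ≤ R → |y| ≤ 3 * |b| → |y| ≤ R →
        |f x - f y| ≤ 3 * L * |b| * |x - y| := by
      intro x y hx hxR hy hyR
      refine (convex_Icc (-min (3 * |b|) R)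
        (min (3 * |b|) R)).norm_image_sub_le_of_norm_hasDerivWithin_le
        (fun t _ => (hf t).hasDerivWithinAt) (fun t ht => ?_)
        (abs_le.1 (le_min hy hyR)) (abs_le.1 (le_min hx hxR))
      have := abs_le.2 ht
      exact hmem (this.trans (min_le_left _ _)) (this.trans (min_le_right _ _))
    have hf00 : f 0 = 0 := by
      have := hodd 0
      rw [neg_zero] at this; linarith
    have h1 := hlip (2 * b) (-(2 * c)) hb3 hb (by rwa [abs_neg]) (by rwa [abs_neg])
    have hm : |b + c| ≤ |b| := by linarith
    have h2 := hlip (b + c) 0 (by linarith [abs_nonneg b])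
      (by rw [abs_mul, abs_two] at hb; linarith [abs_nonneg b])
      (by simp) (by simpa using (abs_nonneg _).trans hb)
    rw [hodd, show 2 * b - -(2 * c) = 2 * (b + c) by ring, abs_mul, abs_two, sub_neg_eq_add] at h1
    rw [hf00, sub_zero, sub_zero] at h2
    have hnum : |f (2 * b) + f (2 * c) - 2 * f (b + c)| ≤ 12 * L * |b| * |b + c| := by
      have := abs_sub (f (2 * b) + f (2 * c)) (2 * f (b + c))
      rw [abs_mul 2, abs_two] at this
      linarith
    have hdiff : 9 / 4 * |b| ^ 2 ≤ (b - c) ^ 2 := by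
      have h3 : 3 / 2 * |b| ≤ |b - c| := by
        have := abs_sub_abs_le_abs_sub (2 * b) (b + c)
        rw [abs_mul, abs_two, show 2 * b - (b + c) = b - c by ring] at this
        linarith
      rw [← sq_abs (b - c)]
      nlinarith [abs_nonneg b]
    calc 2 * |b| * |f (2 * b) + f (2 * c) - 2 * f (b + c)|
        ≤ 2 * |b| * (12 * L * |b| * |b + c|) := by gcongr
      _ = 24 * |b| ^ 2 * (L * |b + c|) := by ring
      _ ≤ 12 * (b - c) ^ 2 * (L * |b + c|) := by
          gcongr ?_ * _
          nlinarith [sq_nonneg |b|]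
      _ = _ := by ring

namespace AdmissibleMultiplier

variable {s N c₀ : ℝ} {m : ℝ → ℝ}

theorem abs_mul_sq_le (hm : AdmissibleMultiplier s N c₀ m) (hs : 3 / 4 ≤ s) (hs1 : s < 1)
    (hN : 1 ≤ N) {x M : ℝ} (hx : |x| ≤ M) :
    |x| * m x ^ 2 ≤ 2 * (M ^ (2 * s - 1) * N ^ (2 - 2 * s)) := by
  have hN0 : 0 < N := by linarith
  have hM : 0 ≤ M := (abs_nonneg x).trans hx
  rcases eq_or_ne x 0 with rfl | hx0
  · simp only [abs_zero, zero_mul]; positivity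
  have hxp : 0 < |x| := abs_pos.2 hx0
  have hmono : |x| ^ (2 * s - 1) ≤ M ^ (2 * s - 1) :=
    Real.rpow_le_rpow hxp.le hx (by linarith)
  rcases le_total (2 * N) |x| with h | h
  · have e : |x| * m x ^ 2 = |x| ^ (2 * s - 1) * N ^ (2 - 2 * s) := by
      rw [hm.eq_rpow x h, mul_pow, ← Real.rpow_mul_natCast hN0.le, ← Real.rpow_mul_natCast hxp.le,
        mul_left_comm, mul_comm]
      congr 1
      · rw [← Real.rpow_one_add' hxp.le (by push_cast; linarith)]
        congr 1; push_cast; ring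
      · congr 1; push_cast; ring
    rw [e]
    have : |x| ^ (2 * s - 1) * N ^ (2 - 2 * s) ≤ M ^ (2 * s - 1) * N ^ (2 - 2 * s) := by gcongr
    have : 0 ≤ M ^ (2 * s - 1) * N ^ (2 - 2 * s) := by positivity
    linarith
  · have hm1 : m x ^ 2 ≤ 1 := pow_le_one₀ (hm.pos x).le (hm.le_one x)
    have h2 : (2 : ℝ) ^ (2 - 2 * s) ≤ 2 := by
      simpa using Real.rpow_le_rpow_of_exponent_le (x := 2) one_le_two
        (show 2 - 2 * s ≤ 1 by linarith)
    calc |x| * m x ^ 2 ≤ |x| * 1 := by gcongr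
      _ = |x| ^ (2 * s - 1) * |x| ^ (2 - 2 * s) := by
          rw [← Real.rpow_add hxp, mul_one]
          ring_nf
          simp
      _ ≤ M ^ (2 * s - 1) * (2 * N) ^ (2 - 2 * s) := by
          gcongr
          linarith
      _ = 2 ^ (2 - 2 * s) * (M ^ (2 * s - 1) * N ^ (2 - 2 * s)) := by
          rw [Real.mul_rpow two_pos.le hN0.le]; ring
      _ ≤ _ := by gcongr

theorem hasDerivAt (hm : AdmissibleMultiplier s N c₀ m) (x : ℝ) : HasDerivAt m (deriv m x) x :=
  (hm.smooth.differentiable (by norm_num) x).hasDerivAt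

theorem hasDerivAt_deriv (hm : AdmissibleMultiplier s N c₀ m) (x : ℝ) :
    HasDerivAt (deriv m) (deriv (deriv m) x) x := by
  have h : ContDiff ℝ 1 (deriv m) :=
    (contDiff_succ_iff_deriv (n := 1)).1 (by simpa [one_add_one_eq_two] using hm.smooth) |>.2.2
  exact (h.differentiable (by norm_num) x).hasDerivAt

theorem hasDerivAt_cube_mul_sq (hm : AdmissibleMultiplier s N c₀ m) (x : ℝ) :
    HasDerivAt (fun x => x ^ 3 * m x ^ 2)
      (3 * x ^ 2 * m x ^ 2 + 2 * x ^ 3 * m x * deriv m x) x := by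
  refine ((hasDerivAt_pow 3 x).mul ((hm.hasDerivAt x).pow 2)).congr_deriv ?_
  simp only [Pi.pow_apply]
  push_cast
  ring

theorem hasDerivAt_deriv_cube_mul_sq (hm : AdmissibleMultiplier s N c₀ m) (x : ℝ) :
    HasDerivAt (fun x => 3 * x ^ 2 * m x ^ 2 + 2 * x ^ 3 * m x * deriv m x)
      (x * (6 * m x ^ 2 + 12 * m x * (x * deriv m x) + 2 * (x * deriv m x) ^ 2 +
        2 * m x * (x ^ 2 * deriv (deriv m) x))) x := by
  refine ((((hasDerivAt_pow 2 x).const_mul 3).mul ((hm.hasDerivAt x).pow 2)).add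
    ((((hasDerivAt_pow 3 x).const_mul 2).mul (hm.hasDerivAt x)).mul (hm.hasDerivAt_deriv x)))
    |>.congr_deriv ?_
  simp only [Pi.pow_apply, Pi.mul_apply]
  push_cast
  ring

theorem abs_second_deriv_cube_mul_sq_le (hm : AdmissibleMultiplier s N c₀ m)
    (x : ℝ) :
    |x * (6 * m x ^ 2 + 12 * m x * (x * deriv m x) + 2 * (x * deriv m x) ^ 2 +
        2 * m x * (x ^ 2 * deriv (deriv m) x))| ≤
      (6 + 14 * c₀ + 2 * c₀ ^ 2) * (|x| * m x ^ 2) := by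
  rcases eq_or_ne x 0 with rfl | hx
  · simp
  have hp := hm.pos x
  have h1 : |x * deriv m x| ≤ c₀ * m x := by
    have := hm.deriv_le x hx
    rwa [le_div_iff₀ (abs_pos.2 hx), mul_comm, ← abs_mul] at this
  have h2 : |x ^ 2 * deriv (deriv m) x| ≤ c₀ * m x := by
    have := hm.deriv2_le x hx
    rwa [le_div_iff₀ (by positivity), mul_comm, ← abs_of_nonneg (sq_nonneg x), ← abs_mul] at this
  rw [abs_mul, mul_left_comm (6 + 14 * c₀ + 2 * c₀ ^ 2)]
  refine mul_le_mul_of_nonneg_left ?_ (abs_nonneg x)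
  generalize x * deriv m x = p at *
  generalize x ^ 2 * deriv (deriv m) x = q at *
  generalize m x = r at *
  have hp2 : p ^ 2 ≤ (c₀ * r) ^ 2 := sq_le_sq' (abs_le.1 h1).1 (abs_le.1 h1).2
  rw [abs_le] at h1 h2 ⊢
  constructor <;> nlinarith [mul_le_mul_of_nonneg_left h1.1 hp.le,
    mul_le_mul_of_nonneg_left h1.2 hp.le, mul_le_mul_of_nonneg_left h2.1 hp.le,
    mul_le_mul_of_nonneg_left h2.2 hp.le, sq_nonneg p, sq_nonneg (c₀ * r), sq_nonneg r]

end AdmissibleMultiplier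

theorem alpha3_eq {a b c : ℝ} (h : a + b + c = 0) :
    alpha3 a b c = 3 * (b + c) * (b - c) ^ 2 := by
  obtain rfl : a = -(b + c) := by linarith
  rw [alpha3]; ring

/-- Lemma 3.2, bound for `M₄₂(ξ₁,ξ₂,ξ₃,ξ₄) = 2(ξ₂+ξ₃)·σ₃(ξ₁,ξ₂+ξ₃,ξ₄)`:
`|M₄₂| ≤ C·N_max^{2s-1}·N^{2-2s}` with `C = C(s, c₀)`. -/
theorem M42_bound (s c₀ : ℝ) (hs : 3 / 4 ≤ s) (hs1 : s < 1) (hc₀ : 0 < c₀) :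
    ∃ C : ℝ, 0 < C ∧
      ∀ N : ℝ, 1 ≤ N → ∀ m₁ : ℝ → ℝ, AdmissibleMultiplier s N c₀ m₁ →
        ∀ ξ₁ ξ₂ ξ₃ ξ₄ : ℝ, ξ₁ + ξ₂ + ξ₃ + ξ₄ = 0 →
          alpha3 ξ₁ (ξ₂ + ξ₃) ξ₄ ≠ 0 →
          |2 * (ξ₂ + ξ₃) * sigma3 m₁ ξ₁ (ξ₂ + ξ₃) ξ₄| ≤
            C * (max |ξ₁| (max |ξ₂| (max |ξ₃| |ξ₄|))) ^ (2 * s - 1) * N ^ (2 - 2 * s) := by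
  set K := 6 + 14 * c₀ + 2 * c₀ ^ 2
  have hKpos : 0 < K := by positivity
  refine ⟨16 * K, by positivity, ?_⟩
  intro N hN m₁ hm ξ₁ ξ₂ ξ₃ ξ₄ hsum hα
  set M := max |ξ₁| (max |ξ₂| (max |ξ₃| |ξ₄|)) with hM
  have hM2 : |ξ₂| ≤ M := by simp [hM]
  have hM3 : |ξ₃| ≤ M := by simp [hM]
  have hM4 : |ξ₄| ≤ M := by simp [hM]
  have hM0 : 0 ≤ M := (abs_nonneg _).trans hM2
  have hb : |2 * (ξ₂ + ξ₃)| ≤ 4 * M := by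
    rw [abs_mul, abs_two]; linarith [abs_add_le ξ₂ ξ₃]
  have hc : |2 * ξ₄| ≤ 4 * M := by
    rw [abs_mul, abs_two]; linarith
  have hsum' : ξ₁ + (ξ₂ + ξ₃) + ξ₄ = 0 := by linarith
  generalize ξ₂ + ξ₃ = b at *
  rw [alpha3_eq hsum'] at hα
  set G := M ^ (2 * s - 1) * N ^ (2 - 2 * s) with hG
  have hG0 : 0 ≤ G := by positivity
  have hscale : (4 * M) ^ (2 * s - 1) * N ^ (2 - 2 * s) ≤ 4 * G := by
    have h4 : (4 : ℝ) ^ (2 * s - 1) ≤ 4 := by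
      simpa using Real.rpow_le_rpow_of_exponent_le (x := 4) (by norm_num)
        (show 2 * s - 1 ≤ 1 by linarith)
    rw [Real.mul_rpow (by norm_num) hM0, mul_assoc]
    gcongr
  have hLip : ∀ x y : ℝ, |x| ≤ 4 * M → |y| ≤ 4 * M →
      |(3 * x ^ 2 * m₁ x ^ 2 + 2 * x ^ 3 * m₁ x * deriv m₁ x) -
        (3 * y ^ 2 * m₁ y ^ 2 + 2 * y ^ 3 * m₁ y * deriv m₁ y)| ≤ 8 * K * G * |x - y| := by
    intro x y hx hy
    refine (convex_Icc (-(4 * M)) (4 * M)).norm_image_sub_le_of_norm_hasDerivWithin_le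
      (fun t _ => (hm.hasDerivAt_deriv_cube_mul_sq t).hasDerivWithinAt) (fun t ht => ?_)
      (abs_le.1 hy) (abs_le.1 hx)
    calc _ ≤ K * (|t| * m₁ t ^ 2) := hm.abs_second_deriv_cube_mul_sq_le t
      _ ≤ K * (2 * (4 * G)) := by
          refine mul_le_mul_of_nonneg_left ?_ hKpos.le
          exact (hm.abs_mul_sq_le hs hs1 hN (abs_le.2 ht)).trans (by gcongr)
      _ = 8 * K * G := by ring
  have hbc : b + ξ₄ ≠ 0 := fun h => hα (by rw [h]; ring)
  have hne : b - ξ₄ ≠ 0 := fun h => hα (by rw [h]; ring)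
  have key := abs_mul_second_difference_div_le (L := 8 * K * G) (by positivity)
    hm.hasDerivAt_cube_mul_sq (fun x => by rw [hm.even]; ring) (by simp) hLip hb hc hbc hne
  have hσ : sigma3 m₁ ξ₁ b ξ₄ = ((2 * b) ^ 3 * m₁ (2 * b) ^ 2 + (2 * ξ₄) ^ 3 * m₁ (2 * ξ₄) ^ 2 -
      2 * ((b + ξ₄) ^ 3 * m₁ (b + ξ₄) ^ 2)) / (6 * (b + ξ₄) * (b - ξ₄) ^ 2) := by
    rw [sigma3, alpha3_eq hsum', show ξ₁ = -(b + ξ₄) by linarith, hm.even]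
    field_simp
    ring
  rw [hσ]
  calc _ ≤ 2 * (8 * K * G) := key
    _ = 16 * K * M ^ (2 * s - 1) * N ^ (2 - 2 * s) := by rw [hG]; ring
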